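/- Let V be a real normed vector space and S ⊆ V a subset whose Kolmogorov n-widths decay at most exponentially, i.e., there exist M > 0, a > 0 and α > 0 with d_m(S;V) ≥ M · exp(−a · m^α) for all m ≥ 1. Then for every p ≥ 2 and every n ≥ 4, the polynomial manifold (n,p)-width satisfies δ^poly_{n,p}(S;V) ≥ M · exp(−a · n^(αp)). -/

import Mathlib

open scoped ENNReal NNReal

noncomputable section

variable {V : Type*} [NormedAddCommGroup V] [NormedSpace ℝ V]

/-- Worst best-approximation error of `S` in `T`, valued in `[0,∞]`:
`dist(S,T) = sup_{s ∈ S} inf_{t ∈ T} ‖s - t‖`. -/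
def distSet (S T : Set V) : ℝ≥0∞ :=
  ⨆ s ∈ S, ⨅ t ∈ T, (‖s - t‖₊ : ℝ≥0∞)

/-- Kolmogorov `n`-width: infimum of `dist(S,U)` over linear subspaces `U` of dimension
at most `n`. -/
def kolWidth (n : ℕ) (S : Set V) : ℝ≥0∞ :=
  ⨅ (U : Submodule ℝ V) (_ : Module.rank ℝ U ≤ n), distSet S (U : Set V)

/-- Multi-indices on `Fin l` of total degree at most `p`. -/
def multiIndices (l p : ℕ) : Finset (Fin l → ℕ) :=
  (Fintype.piFinset fun _ => Finset.range (p + 1)).filter fun α => ∑ i, α i ≤ p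

/-- `D : ℝ^l → V` is a polynomial mapping of degree `p`:
`D x = Σ_{|α| ≤ p} x^α • v_α` for some coefficient vectors `v_α ∈ V`. -/
def IsPolyMap {l : ℕ} (p : ℕ) (D : (Fin l → ℝ) → V) : Prop :=
  ∃ v : (Fin l → ℕ) → V, ∀ x, D x = ∑ α ∈ multiIndices l p, (∏ i, x i ^ α i) • v α

/-- `s(n,p) = Σ_{k=0}^p C(n+k-1, k)`, the number of multi-indices of degree at most `p`. -/
def sTot (n p : ℕ) : ℕ := ∑ k ∈ Finset.range (p + 1), Nat.choose (n + k - 1) k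

/-- Polynomial Kolmogorov `(n,p)`-width: infimum of `dist(S, image D)` over `l ≤ n` and
polynomial mappings `D` of degree `p` on `ℝ^l`. -/
def polyKolWidth (n p : ℕ) (S : Set V) : ℝ≥0∞ :=
  ⨅ (l : ℕ) (_ : l ≤ n) (D : (Fin l → ℝ) → V) (_ : IsPolyMap p D),
    distSet S (Set.range D)

/-- Polynomial manifold `(n,p)`-width: infimum over `l ≤ n`, polynomial mappings `D` of
degree `p` on `ℝ^l` and continuous encoders `e : V → ℝ^l` of `sup_{s ∈ S} ‖s - D (e s)‖`. -/
def polyManiWidth (n p : ℕ) (S : Set V) : ℝ≥0∞ :=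
  ⨅ (l : ℕ) (_ : l ≤ n) (D : (Fin l → ℝ) → V) (_ : IsPolyMap p D)
    (e : V → (Fin l → ℝ)) (_ : Continuous e),
    ⨆ s ∈ S, (‖s - D (e s)‖₊ : ℝ≥0∞)

lemma multiIndices_card_le (l p : ℕ) : (multiIndices l p).card ≤ (l + p).choose p := by
  have h1 := Finset.card_finsuppAntidiag_nat_eq_choose (s := (Finset.univ : Finset (Fin (l + 1)))) p
  have h2 : (multiIndices l p).card ≤
      ((Finset.univ : Finset (Fin (l + 1))).finsuppAntidiag p).card := by
    refine Finset.card_le_card_of_injOn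
      (fun β => Finsupp.equivFunOnFinite.symm (Fin.cons (p - ∑ i, β i) β)) ?_ ?_
    · intro β hβ
      have hs : ∑ i, β i ≤ p := by
        have := Finset.mem_coe.1 hβ
        unfold multiIndices at this
        exact (Finset.mem_filter.1 this).2
      simp only [Finset.mem_coe, Finset.mem_finsuppAntidiag]
      refine ⟨?_, Finset.subset_univ _⟩
      rw [Fin.sum_univ_succ]
      simp
      omega
    · intro β _ γ _ hbc
      have h3 := Finsupp.equivFunOnFinite.symm.injective hbc
      exact (Fin.cons_inj.1 h3).2
  rw [h1] at h2
  simpa [Nat.add_right_comm] using h2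

lemma choose_le_pow_aux (n p : ℕ) (hp : 2 ≤ p) (hn : 4 ≤ n) : (n + p).choose p ≤ n ^ p := by
  induction p, hp using Nat.le_induction with
  | base =>
    rw [Nat.choose_two_right]
    apply Nat.div_le_of_le_mul
    have : n + 2 - 1 = n + 1 := by omega
    rw [this]
    nlinarith
  | succ p hp ih =>
    have h1 := Nat.add_one_mul_choose_eq (n + p) p
    have h2 : n + p + 1 ≤ n * (p + 1) := by nlinarith
    have h3 : (n + p + 1).choose (p + 1) * (p + 1) ≤ n ^ (p + 1) * (p + 1) := by
      rw [← h1]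
      calc (n + p + 1) * (n + p).choose p ≤ (n * (p + 1)) * n ^ p := Nat.mul_le_mul h2 ih
        _ = n ^ (p + 1) * (p + 1) := by ring
    exact Nat.le_of_mul_le_mul_right h3 (Nat.succ_pos p)

/-- if the Kolmogorov widths of `S` decay at most exponentially, i.e.
`d_m(S;V) ≥ M exp(-a m^α)` for all `m ≥ 1`, then for `p ≥ 2` and `n ≥ 4` the polynomial
manifold `(n,p)`-width satisfies `δ^poly_{n,p}(S;V) ≥ M exp(-a n^{αp})`. -/
theorem stmt11 (V : Type*) [NormedAddCommGroup V] [NormedSpace ℝ V]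
    (S : Set V) (M a α : ℝ) (hM : 0 < M) (ha : 0 < a) (hα : 0 < α)
    (h : ∀ m : ℕ, 1 ≤ m →
      ENNReal.ofReal (M * Real.exp (-a * (m : ℝ) ^ α)) ≤ kolWidth m S)
    (p n : ℕ) (hp : 2 ≤ p) (hn : 4 ≤ n) :
    ENNReal.ofReal (M * Real.exp (-a * (n : ℝ) ^ (α * (p : ℝ)))) ≤ polyManiWidth n p S := by
  classical
  have hm := h (n ^ p) (Nat.one_le_pow _ _ (by omega))
  have he : (((n ^ p : ℕ) : ℝ)) ^ α = (n : ℝ) ^ (α * (p : ℝ)) := by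
    rw [mul_comm, Real.rpow_mul (Nat.cast_nonneg n), Real.rpow_natCast, Nat.cast_pow]
  rw [he] at hm
  refine hm.trans ?_
  unfold polyManiWidth
  refine le_iInf fun l => le_iInf fun hl => le_iInf fun D => le_iInf fun hD =>
    le_iInf fun e => le_iInf fun _ => ?_
  obtain ⟨v, hv⟩ := hD
  let U : Submodule ℝ V := Submodule.span ℝ (((multiIndices l p).image v : Finset V) : Set V)
  have hU : Module.rank ℝ U ≤ ((n ^ p : ℕ) : Cardinal) := by
    refine (rank_span_finset_le _).trans ?_
    have : ((multiIndices l p).image v).card ≤ n ^ p :=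
      Finset.card_image_le.trans ((multiIndices_card_le l p).trans
        ((Nat.choose_le_choose p (by omega)).trans (choose_le_pow_aux n p hp hn)))
    exact_mod_cast this
  unfold kolWidth
  refine (iInf₂_le U hU).trans ?_
  unfold distSet
  refine iSup₂_mono fun s _ => ?_
  refine iInf₂_le (D (e s)) ?_
  rw [hv]
  refine Submodule.sum_mem _ fun β hβ => Submodule.smul_mem _ _ (Submodule.subset_span ?_)
  exact Finset.mem_coe.2 (Finset.mem_image_of_mem v hβ)

end
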